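/- Let (R, m) be a Cohen–Macaulay Noetherian local ring with μ(m) ≤ dim R + 1 (i.e., R is a hypersurface) and with m² ≠ 0. Then cs(R) = μ(m). -/

import Mathlib

open IsLocalRing

/-- The minimal number of generators of an ideal. -/
noncomputable def mu {R : Type*} [CommRing R] (I : Ideal R) : ℕ :=
  sInf {n : ℕ | ∃ s : Finset R, s.card = n ∧ Ideal.span (s : Set R) = I}

/-- `cs R = min {μ(I) : I² = m²}`. -/
noncomputable def cs (R : Type*) [CommRing R] [IsLocalRing R] : ℕ :=
  sInf {n : ℕ | ∃ I : Ideal R, I ^ 2 = (maximalIdeal R) ^ 2 ∧ mu I = n}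

/-- The depth of a local ring `R`: the supremum of the lengths of `R`-regular sequences
consisting of elements of the maximal ideal. -/
noncomputable def depth (R : Type*) [CommRing R] [IsLocalRing R] : ℕ∞ :=
  sSup {n : ℕ∞ | ∃ rs : List R, (rs.length : ℕ∞) = n ∧
    (∀ r ∈ rs, r ∈ maximalIdeal R) ∧ RingTheory.Sequence.IsRegular R rs}

/-- A local ring is Cohen–Macaulay if its depth equals its Krull dimension. -/
def IsCohenMacaulayLocalRing (R : Type*) [CommRing R] [IsLocalRing R] : Prop :=
  (depth R : WithBot ℕ∞) = ringKrullDim R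

section Helpers

open RingTheory.Sequence CategoryTheory Abelian Limits Pointwise

universe u

/-- `M` has a regular sequence of length `n` in the maximal ideal. -/
def HasReg (R : Type u) [CommRing R] [IsLocalRing R] (M : Type u) [AddCommGroup M] [Module R M]
    (n : ℕ) : Prop :=
  ∃ rs : List R, rs.length = n ∧ (∀ r ∈ rs, r ∈ maximalIdeal R) ∧ IsRegular M rs

lemma HasReg.quot {R : Type u} [CommRing R] [IsLocalRing R] [IsNoetherianRing R]
    {M : Type u} [AddCommGroup M] [Module R M] [Module.Finite R M] {n : ℕ}
    (h : HasReg R M (n + 1)) {x : R} (hx : x ∈ maximalIdeal R) (hreg : IsSMulRegular M x) :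
    HasReg R (QuotSMulTop x M) n := by
  obtain ⟨rs, hlen, hmem, hrs⟩ := h
  have : Nontrivial M := hrs.nontrivial
  have key : ∀ (M : Type u) [AddCommGroup M] [Module R M] [Module.Finite R M] [Nontrivial M],
      maximalIdeal R • (⊤ : Submodule R M) < ⊤ := fun M _ _ _ _ =>
    (Submodule.top_ne_ideal_smul_of_le_jacobson_annihilator
      (IsLocalRing.maximalIdeal_le_jacobson _)).symm.lt_top
  have t1 := (ModuleCat.exists_isRegular_tfae.{u} (maximalIdeal R) (n + 1) (ModuleCat.of R M)
    (key M)).out 3 1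
  have e1 := t1.mp ⟨rs, hlen, hmem, hrs⟩
  have : Nontrivial (QuotSMulTop x M) := nontrivial_quotSMulTop_of_mem_maximalIdeal M hx
  have t2 := (ModuleCat.exists_isRegular_tfae.{u} (maximalIdeal R) n
    (ModuleCat.of R (QuotSMulTop x M)) (key _)).out 1 3
  refine t2.mp ?_
  intro i hi
  have zero1 := AddCommGrpCat.isZero_of_iff_subsingleton.mpr (e1 i (by omega))
  have zero2 := AddCommGrpCat.isZero_of_iff_subsingleton.mpr (e1 (i + 1) (by omega))
  exact AddCommGrpCat.subsingleton_of_isZero <| ShortComplex.Exact.isZero_of_both_zeros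
    ((Ext.covariant_sequence_exact₃' _
      (IsSMulRegular.smulShortComplex_shortExact (M := ModuleCat.of R M) hreg)) i (i + 1) rfl)
    (zero1.eq_zero_of_src _) (zero2.eq_zero_of_tgt _)

lemma HasReg.quotIdeal {R : Type u} [CommRing R] [IsLocalRing R] [IsNoetherianRing R]
    {I : Ideal R} {n : ℕ} (h : HasReg R (R ⧸ I) (n + 1)) {x : R} (hx : x ∈ maximalIdeal R)
    (hreg : IsSMulRegular (R ⧸ I) x) :
    HasReg R (R ⧸ (I ⊔ Ideal.span {x})) n := by
  obtain ⟨rs, hlen, hmem, hrs⟩ := h.quot hx hreg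
  refine ⟨rs, hlen, hmem, ?_⟩
  have hmap : x • (⊤ : Submodule R (R ⧸ I)) = Submodule.map (Submodule.mkQ I) (I ⊔ Ideal.span {x}) := by
    ext y
    obtain ⟨y, rfl⟩ := Submodule.mkQ_surjective I y
    simp only [Submodule.mem_smul_pointwise_iff_exists, Submodule.mem_map]
    constructor
    · rintro ⟨b, -, hb⟩
      obtain ⟨b, rfl⟩ := Submodule.mkQ_surjective I b
      exact ⟨x * b, Ideal.mul_mem_right _ _ (Ideal.mem_sup_right
        (Ideal.mem_span_singleton_self x)), hb⟩
    · rintro ⟨b, hb, hby⟩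
      obtain ⟨i, hi, z, hz, rfl⟩ := Submodule.mem_sup.mp hb
      obtain ⟨c, rfl⟩ := Ideal.mem_span_singleton'.mp hz
      refine ⟨Submodule.mkQ I c, trivial, ?_⟩
      rw [← hby, map_add, (Submodule.Quotient.mk_eq_zero I (x := i)).mpr hi |> fun h => (h :
        Submodule.mkQ I i = 0), zero_add, ← map_smul, smul_eq_mul, mul_comm]
  exact ((Submodule.quotEquivOfEq _ _ hmap).trans
    (Submodule.quotientQuotientEquivQuotient I (I ⊔ Ideal.span {x}) le_sup_left)).isRegular_congr rs
      |>.mp hrs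

lemma reg_iff {R : Type u} [CommRing R] (J : Ideal R) (y : R) :
    IsSMulRegular (R ⧸ J) y ↔ ∀ r, y * r ∈ J → r ∈ J :=
  isSMulRegular_quotient_iff_mem_of_smul_mem J y

lemma exchange {R : Type u} [CommRing R] [IsLocalRing R] (I0 : Ideal R) (t : Finset R) (x : R)
    (hx : x ∈ I0 ⊔ Ideal.span (t : Set R))
    (hx' : x ∉ I0 ⊔ maximalIdeal R * (I0 ⊔ Ideal.span (t : Set R))) :
    ∃ t' : Finset R, t'.card + 1 ≤ t.card ∧
      (I0 ⊔ Ideal.span {x}) ⊔ Ideal.span (t' : Set R) = I0 ⊔ Ideal.span (t : Set R) := by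
  classical
  obtain ⟨i, hi, z, hz, rfl⟩ := Submodule.mem_sup.mp hx
  obtain ⟨c, -, hc⟩ := Submodule.mem_span_finset.mp hz
  have : ∃ a ∈ t, c a ∉ maximalIdeal R := by
    by_contra! hcon
    refine hx' (Ideal.add_mem _ (Ideal.mem_sup_left hi) (Ideal.mem_sup_right ?_))
    rw [← hc]
    exact Ideal.sum_mem _ fun a ha => Ideal.mul_mem_mul (hcon a ha)
      (Ideal.mem_sup_right (Ideal.subset_span ha))
  obtain ⟨a, ha, hca⟩ := this
  refine ⟨t.erase a, (Finset.card_erase_add_one ha).le, le_antisymm ?_ ?_⟩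
  · refine sup_le (sup_le le_sup_left ?_) (le_sup_of_le_right (Ideal.span_mono ?_))
    · rw [Ideal.span_singleton_le_iff_mem]; exact hx
    · exact_mod_cast Finset.erase_subset a t
  · refine sup_le (le_sup_of_le_left le_sup_left) (Ideal.span_le.mpr fun b hb => ?_)
    by_cases hba : b = a
    · subst hba
      have hu : IsUnit (c b) := by simpa using hca
      refine (Ideal.unit_mul_mem_iff_mem _ hu).mp ?_
      have : c b * b = (i + z) - i - ∑ a ∈ t.erase b, c a • a := by
        rw [← hc, ← Finset.add_sum_erase _ _ ha, smul_eq_mul]; ring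
      rw [this]
      refine Ideal.sub_mem _ (Ideal.sub_mem _ ?_ ?_) (Ideal.sum_mem _ fun a ha => ?_)
      · exact Ideal.mem_sup_left (Ideal.mem_sup_right (Ideal.mem_span_singleton_self _))
      · exact Ideal.mem_sup_left (Ideal.mem_sup_left hi)
      · exact Ideal.mul_mem_left _ _ (Ideal.mem_sup_right (Ideal.subset_span ha))
    · exact Ideal.mem_sup_right (Ideal.subset_span (by simpa using ⟨hb, hba⟩))

lemma main_ind {R : Type u} [CommRing R] [IsLocalRing R] [IsNoetherianRing R]
    (I : Ideal R) (hI : I ≤ maximalIdeal R) (hmI : maximalIdeal R ^ 2 ≤ I) (n : ℕ) :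
    ∀ (I0 : Ideal R) (t : Finset R), t.card ≤ n + 1 → I0 ⊔ Ideal.span (t : Set R) = I →
      HasReg R (R ⧸ I0) (n + 1) →
      ∃ (J : Ideal R) (y : R), J ⊔ Ideal.span {y} = I ∧ ∀ r, y * r ∈ J → r ∈ J := by
  induction n with
  | zero => ?_
  | succ n ih => ?_
  all_goals
    intro I0 t ht hIt hreg
    have hx : ∃ x ∈ I, x ∉ I0 ⊔ maximalIdeal R * I ∧ IsSMulRegular (R ⧸ I0) x := by
      obtain ⟨rs, hlen, hmem, hrs⟩ := id hreg
      match rs, hlen with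
      | a :: rs, _ =>
      have ha : IsSMulRegular (R ⧸ I0) (a ^ 2) := ((isRegular_cons_iff _ _ _).mp hrs).1.pow 2
      have haI : a ^ 2 ∈ I := hmI (Ideal.pow_mem_pow (hmem a (by simp)) 2)
      by_contra! hcon
      have hsub : (I : Set R) ⊆ ⋃ p ∈ insert (I0 ⊔ maximalIdeal R * I)
          (associatedPrimes R (R ⧸ I0)), ((id p : Ideal R) : Set R) := by
        intro x hx
        by_cases h1 : x ∈ I0 ⊔ maximalIdeal R * I
        · exact Set.mem_biUnion (Set.mem_insert _ _) h1
        · have h2 : x ∈ ⋃ p ∈ associatedPrimes R (R ⧸ I0), (p : Set R) := by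
            rw [biUnion_associatedPrimes_eq_compl_regular R (R ⧸ I0)]
            exact hcon x hx h1
          exact Set.biUnion_subset_biUnion_left (Set.subset_insert _ _) h2
      obtain ⟨p, hp, hIp⟩ := (Ideal.subset_union_prime_finite
        ((associatedPrimes.finite R (R ⧸ I0)).insert _) (I0 ⊔ maximalIdeal R * I)
        (I0 ⊔ maximalIdeal R * I) (fun p hp hne _ => by
          rcases hp with rfl | hp
          · exact absurd rfl hne
          · exact IsAssociatedPrime.isPrime hp)).mp hsub
      rcases hp with rfl | hp
      · have hle : I ≤ I0 := by
          refine Submodule.le_of_le_smul_of_le_jacobson_bot (I := maximalIdeal R)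
            (IsNoetherian.noetherian I) (IsLocalRing.maximalIdeal_le_jacobson _) ?_
          exact hIp
        have := (reg_iff I0 (a ^ 2)).mp ha 1 (by simpa using hle haI)
        have h1 : (1 : R) ∈ maximalIdeal R := hI (hIt ▸ Ideal.mem_sup_left this)
        exact (maximalIdeal.isMaximal R).ne_top ((Ideal.eq_top_iff_one _).mpr h1)
      · have h2 : a ^ 2 ∈ ⋃ p ∈ associatedPrimes R (R ⧸ I0), (p : Set R) :=
          Set.mem_biUnion hp (hIp haI)
        rw [biUnion_associatedPrimes_eq_compl_regular R (R ⧸ I0)] at h2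
        exact h2 ha
    obtain ⟨x, hxI, hxn, hxr⟩ := hx
    obtain ⟨t', ht', hspan⟩ := exchange I0 t x (hIt ▸ hxI) (hIt ▸ hxn)
  · have : t' = ∅ := Finset.card_eq_zero.mp (by omega)
    subst this
    refine ⟨I0, x, ?_, (reg_iff _ _).mp hxr⟩
    rw [← hIt, ← hspan]; simp
  · exact ih (I0 ⊔ Ideal.span {x}) t' (by omega) (hspan.trans hIt) (hreg.quotIdeal (hI hxI) hxr)

lemma mu_spec {R : Type*} [CommRing R] [IsNoetherianRing R] (I : Ideal R) :
    ∃ s : Finset R, s.card = mu I ∧ Ideal.span (s : Set R) = I := by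
  have : {n : ℕ | ∃ s : Finset R, s.card = n ∧ Ideal.span (s : Set R) = I}.Nonempty := by
    obtain ⟨s, hs⟩ := IsNoetherian.noetherian I
    exact ⟨_, s, rfl, hs⟩
  exact Nat.sInf_mem this

lemma exists_reg {R : Type u} [CommRing R] [IsLocalRing R] {n : ℕ}
    (h : (n : ℕ∞) + 1 ≤ depth R) : HasReg R R (n + 1) := by
  have h1 : (n : ℕ∞) < depth R := by
    refine lt_of_lt_of_le ?_ h
    exact_mod_cast Nat.lt_succ_self n
  obtain ⟨_, ⟨rs, rfl, hmem, hrs⟩, hlt⟩ := lt_sSup_iff.mp h1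
  have hlt : n < rs.length := by exact_mod_cast hlt
  refine ⟨rs.take (n + 1), by simp; omega, fun r hr => hmem r (List.mem_of_mem_take hr), ?_⟩
  have hw := hrs.toIsWeaklyRegular
  rw [← List.take_append_drop (n + 1) rs, isWeaklyRegular_append_iff] at hw
  refine ⟨hw.1, fun htop => hrs.top_ne_smul (le_antisymm ?_ le_top)⟩
  conv_lhs => rw [htop]
  refine Submodule.smul_mono_left (Ideal.span_mono fun r hr => ?_)
  exact List.mem_of_mem_take hr

end Helpers

/-- Let `(R, m)` be a Cohen–Macaulay Noetherian local ring with `μ(m) ≤ dim R + 1`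
(i.e. `R` is a hypersurface) and `m² ≠ 0`.  Then `cs(R) = μ(m)`. -/
theorem stmt12 {R : Type*} [CommRing R] [IsLocalRing R] [IsNoetherianRing R]
    (hCM : IsCohenMacaulayLocalRing R)
    (hhyp : (mu (maximalIdeal R) : WithBot ℕ∞) ≤ ringKrullDim R + 1)
    (hm2 : (maximalIdeal R) ^ 2 ≠ ⊥) :
    cs R = mu (maximalIdeal R) := by
  refine le_antisymm (Nat.sInf_le ⟨_, rfl, rfl⟩) (le_csInf ⟨_, _, rfl, rfl⟩ ?_)
  rintro _ ⟨I, hI2, rfl⟩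
  by_contra! hlt
  obtain ⟨t, htc, ht⟩ := mu_spec I
  have hIm : I ≤ maximalIdeal R := by
    refine IsLocalRing.le_maximalIdeal fun htop => ?_
    have h1 : maximalIdeal R = ⊤ := top_le_iff.mp (by
      calc ⊤ = I ^ 2 := by rw [htop, sq, Ideal.top_mul]
        _ = maximalIdeal R ^ 2 := hI2
        _ ≤ _ := Ideal.pow_le_self two_ne_zero)
    exact (maximalIdeal.isMaximal R).ne_top h1
  have hdep : (mu (maximalIdeal R) : ℕ∞) ≤ depth R + 1 := by
    rw [← hCM] at hhyp
    exact_mod_cast hhyp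
  have h0 : mu I ≠ 0 := by
    intro h0
    rw [h0, Finset.card_eq_zero] at htc
    subst htc
    apply hm2
    rw [← hI2, ← ht]
    simp
  obtain ⟨n, hn⟩ : ∃ n, mu (maximalIdeal R) = n + 2 := ⟨mu (maximalIdeal R) - 2, by omega⟩
  have hd : (n : ℕ∞) + 1 ≤ depth R := by
    rw [hn] at hdep
    have : (n : ℕ∞) + 1 + 1 ≤ depth R + 1 := by
      rw [add_assoc, one_add_one_eq_two]; exact_mod_cast hdep
    exact (ENat.add_le_add_iff_right ENat.one_ne_top).mp this
  have hreg : HasReg R (R ⧸ (⊥ : Ideal R)) (n + 1) := by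
    obtain ⟨rs, hl, hm, hr⟩ := exists_reg hd
    exact ⟨rs, hl, hm, ((Submodule.quotEquivOfEqBot (⊥ : Ideal R) rfl).isRegular_congr rs).mpr hr⟩
  obtain ⟨J, y, hJ, hy⟩ := main_ind I hIm (hI2 ▸ Ideal.pow_le_self two_ne_zero) n ⊥ t (by omega)
    (by simpa using ht) hreg
  have hmI : maximalIdeal R ≤ I := by
    intro r hr
    have hyI : y ∈ I := hJ ▸ Ideal.mem_sup_right (Ideal.mem_span_singleton_self y)
    have h1 : y * r ∈ I * I := by
      rw [← sq, hI2, sq]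
      exact Ideal.mul_mem_mul (hIm hyI) hr
    have h2 : I * I ≤ J ⊔ Ideal.span {y} * I := by
      conv_lhs => rw [← hJ, Ideal.sup_mul, hJ]
      exact sup_le_sup_right Ideal.mul_le_left _
    obtain ⟨j, hj, z, hz, hjz⟩ := Submodule.mem_sup.mp (h2 h1)
    obtain ⟨s, hs, rfl⟩ := Ideal.mem_span_singleton_mul.mp hz
    have h3 : r - s ∈ J := hy _ (by
      have : y * (r - s) = j := by rw [mul_sub, ← hjz]; ring
      rwa [this])
    have h4 : r - s ∈ I := hJ ▸ Ideal.mem_sup_left h3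
    simpa using Ideal.add_mem _ h4 hs
  rw [le_antisymm hIm hmI] at hlt
  exact lt_irrefl _ hlt
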